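/- Let E₁ = E₂ = {(0,0),(1,0),(2,0),(1,1),(2,1),(3,1)} ⊂ ℤ² be the common support of the 2×2 example system F := (1+2x−2x²y−5xy+x²+3x³y, 2+6x−6x²y−11xy+4x²+5x³y). Then the mixed area M(E₁,E₂) equals 4, and the pair D := ({(0,0),(3,1)}, {(1,1),(2,0)}) is an irreducible fill of (E₁,E₂): D₁ ⊆ E₁, D₂ ⊆ E₂, M(conv D₁, conv D₂) = 4, and no pair D' with D'_i ⊆ D_i for all i and D'_j ⊊ D_j for some j fills (E₁,E₂). -/

import Mathlib

open MeasureTheory Pointwise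

/-- The mixed area of a pair of subsets of `ℝ²`:
`M(A,B) = vol(A + B) - vol(A) - vol(B)`, `+` being Minkowski sum. -/
noncomputable def mixedArea (A B : Set (ℝ × ℝ)) : ℝ :=
  (volume (A + B)).toReal - (volume A).toReal - (volume B).toReal

/-- The common support `E = {(0,0),(1,0),(2,0),(1,1),(2,1),(3,1)}` of the 2×2 example
system, viewed in `ℝ²`. -/
def exampleSupport : Set (ℝ × ℝ) :=
  {((0:ℝ), (0:ℝ)), (1, 0), (2, 0), (1, 1), (2, 1), (3, 1)}

/-- The linear map `(s, t) ↦ s • u + t • v` of the plane. -/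
noncomputable def planeMap (u v : ℝ × ℝ) : ℝ × ℝ →ₗ[ℝ] ℝ × ℝ :=
  (LinearMap.toSpanSingleton ℝ (ℝ × ℝ) u).coprod (LinearMap.toSpanSingleton ℝ (ℝ × ℝ) v)

theorem det_planeMap (u v : ℝ × ℝ) :
    LinearMap.det (planeMap u v) = u.1 * v.2 - v.1 * u.2 := by
  rw [← LinearMap.det_toMatrix (Module.Basis.finTwoProd ℝ), Matrix.det_fin_two]
  simp [LinearMap.toMatrix_apply, planeMap]

theorem segment_add_segment_eq_vadd_image (a b c d : ℝ × ℝ) :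
    segment ℝ a b + segment ℝ c d =
      (a + c) +ᵥ planeMap (b - a) (d - c) '' (Set.Icc 0 1 ×ˢ Set.Icc 0 1) := by
  ext x
  simp only [segment_eq_image', Set.mem_add, Set.mem_image, Set.mem_vadd_set]
  constructor
  · rintro ⟨_, ⟨s, hs, rfl⟩, _, ⟨t, ht, rfl⟩, rfl⟩
    exact ⟨_, ⟨(s, t), ⟨hs, ht⟩, rfl⟩, by simp [planeMap, add_add_add_comm]⟩
  · rintro ⟨_, ⟨⟨s, t⟩, ⟨hs, ht⟩, rfl⟩, rfl⟩
    exact ⟨_, ⟨s, hs, rfl⟩, _, ⟨t, ht, rfl⟩, by simp [planeMap, add_add_add_comm]⟩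

theorem volume_segment_add_segment (a b c d : ℝ × ℝ) :
    volume (segment ℝ a b + segment ℝ c d) =
      ENNReal.ofReal |(b - a).1 * (d - c).2 - (d - c).1 * (b - a).2| := by
  rw [segment_add_segment_eq_vadd_image, measure_vadd, Measure.addHaar_image_linearMap,
    det_planeMap, Measure.volume_eq_prod, Measure.prod_prod]
  simp

theorem volume_segment_eq_zero (a b : ℝ × ℝ) : volume (segment ℝ a b) = 0 := by
  simpa using volume_segment_add_segment a b 0 0

theorem mixedArea_comm (A B : Set (ℝ × ℝ)) : mixedArea A B = mixedArea B A := by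
  simp only [mixedArea, add_comm A B]
  ring

theorem mixedArea_segment (a b c d : ℝ × ℝ) :
    mixedArea (segment ℝ a b) (segment ℝ c d) =
      |(b - a).1 * (d - c).2 - (d - c).1 * (b - a).2| := by
  simp [mixedArea, volume_segment_eq_zero, volume_segment_add_segment]

theorem mixedArea_self {A : Set (ℝ × ℝ)} (hA : Convex ℝ A) :
    mixedArea A A = 2 * (volume A).toReal := by
  have h : A + A = (2 : ℝ) • A := by
    simpa [one_add_one_eq_two] using (hA.add_smul (zero_le_one' ℝ) (zero_le_one' ℝ)).symm
  rw [mixedArea, h, Measure.addHaar_smul, ENNReal.toReal_mul, ENNReal.toReal_ofReal (abs_nonneg _)]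
  simp
  ring

theorem mixedArea_nonpos_of_subsingleton {A : Set (ℝ × ℝ)} (hA : A.Subsingleton)
    (B : Set (ℝ × ℝ)) : mixedArea A B ≤ 0 := by
  rcases hA.eq_empty_or_singleton with rfl | ⟨a, rfl⟩
  · simp [mixedArea]
  · simp [mixedArea, Set.singleton_add, Set.image_add_left]

theorem Set.subsingleton_of_ssubset_pair {α : Type*} {a b : α} {s : Set α} (h : s ⊂ {a, b}) :
    s.Subsingleton := by
  rcases Set.subset_pair_iff_eq.1 h.subset with rfl | rfl | rfl | rfl
  · exact Set.subsingleton_empty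
  · exact Set.subsingleton_singleton
  · exact Set.subsingleton_singleton
  · exact absurd rfl h.ne

theorem Set.Subsingleton.convexHull {E : Type*} [AddCommGroup E] [Module ℝ E] {s : Set E}
    (hs : s.Subsingleton) : (_root_.convexHull ℝ s).Subsingleton := by
  rwa [hs.convex.convexHull_eq]

theorem convexHull_exampleSupport :
    convexHull ℝ exampleSupport =
      segment ℝ ((0 : ℝ), (0 : ℝ)) (2, 0) + segment ℝ ((0 : ℝ), (0 : ℝ)) (1, 1) := by
  apply Set.Subset.antisymm
  · refine convexHull_min ?_ ((convex_segment _ _).add (convex_segment _ _))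
    have h0 : ((0 : ℝ), (0 : ℝ)) ∈ segment ℝ ((0 : ℝ), (0 : ℝ)) (2, 0) := left_mem_segment _ _ _
    have h1 : ((1 : ℝ), (0 : ℝ)) ∈ segment ℝ ((0 : ℝ), (0 : ℝ)) (2, 0) :=
      ⟨1 / 2, 1 / 2, by norm_num, by norm_num, by norm_num, by simp⟩
    have h2 : ((2 : ℝ), (0 : ℝ)) ∈ segment ℝ ((0 : ℝ), (0 : ℝ)) (2, 0) := right_mem_segment _ _ _
    have k0 : ((0 : ℝ), (0 : ℝ)) ∈ segment ℝ ((0 : ℝ), (0 : ℝ)) (1, 1) := left_mem_segment _ _ _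
    have k1 : ((1 : ℝ), (1 : ℝ)) ∈ segment ℝ ((0 : ℝ), (0 : ℝ)) (1, 1) := right_mem_segment _ _ _
    rintro x (rfl | rfl | rfl | rfl | rfl | rfl)
    · exact ⟨_, h0, _, k0, by norm_num⟩
    · exact ⟨_, h1, _, k0, by norm_num⟩
    · exact ⟨_, h2, _, k0, by norm_num⟩
    · exact ⟨_, h0, _, k1, by norm_num⟩
    · exact ⟨_, h1, _, k1, by norm_num⟩
    · exact ⟨_, h2, _, k1, by norm_num⟩
  · rw [← convexHull_pair, ← convexHull_pair, ← convexHull_add]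
    apply convexHull_mono
    rintro _ ⟨x, rfl | rfl, y, rfl | rfl, rfl⟩ <;> norm_num [exampleSupport]

theorem volume_convexHull_exampleSupport : volume (convexHull ℝ exampleSupport) = 2 := by
  rw [convexHull_exampleSupport, volume_segment_add_segment]
  norm_num

/-- **The fill used for the degenerate 2×2 example.**  The mixed area of
`(E₁, E₂) = (E, E)` with `E = {(0,0),(1,0),(2,0),(1,1),(2,1),(3,1)}` equals `4`, and the
pair `D = ({(0,0),(3,1)}, {(1,1),(2,0)})` is an irreducible fill of `(E₁,E₂)`:
`D₁, D₂ ⊆ E`, `M(conv D₁, conv D₂) = 4`, and no pair obtained from `D` by strictly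
shrinking some entry still fills `(E₁,E₂)`. -/
theorem example_support_irreducible_fill :
    mixedArea (convexHull ℝ exampleSupport) (convexHull ℝ exampleSupport) = 4 ∧
    ({((0:ℝ), (0:ℝ)), ((3:ℝ), (1:ℝ))} : Set (ℝ × ℝ)) ⊆ exampleSupport ∧
    ({((1:ℝ), (1:ℝ)), ((2:ℝ), (0:ℝ))} : Set (ℝ × ℝ)) ⊆ exampleSupport ∧
    mixedArea (convexHull ℝ {((0:ℝ), (0:ℝ)), ((3:ℝ), (1:ℝ))})
      (convexHull ℝ {((1:ℝ), (1:ℝ)), ((2:ℝ), (0:ℝ))}) = 4 ∧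
    ∀ D₁' D₂' : Set (ℝ × ℝ),
      D₁' ⊆ ({((0:ℝ), (0:ℝ)), ((3:ℝ), (1:ℝ))} : Set (ℝ × ℝ)) →
      D₂' ⊆ ({((1:ℝ), (1:ℝ)), ((2:ℝ), (0:ℝ))} : Set (ℝ × ℝ)) →
      (D₁' ⊂ ({((0:ℝ), (0:ℝ)), ((3:ℝ), (1:ℝ))} : Set (ℝ × ℝ)) ∨
        D₂' ⊂ ({((1:ℝ), (1:ℝ)), ((2:ℝ), (0:ℝ))} : Set (ℝ × ℝ))) →
      mixedArea (convexHull ℝ D₁') (convexHull ℝ D₂') ≠ 4 := by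
  refine ⟨?_, ?_, ?_, ?_, ?_⟩
  · rw [mixedArea_self (convex_convexHull ℝ _), volume_convexHull_exampleSupport]
    norm_num
  · rintro x (rfl | rfl) <;> simp [exampleSupport]
  · rintro x (rfl | rfl) <;> simp [exampleSupport]
  · rw [convexHull_pair, convexHull_pair, mixedArea_segment]
    norm_num
  · rintro D₁' D₂' - - h
    refine ne_of_lt (lt_of_le_of_lt ?_ four_pos)
    rcases h with h | h
    · exact mixedArea_nonpos_of_subsingleton (Set.subsingleton_of_ssubset_pair h).convexHull _
    · rw [mixedArea_comm]
      exact mixedArea_nonpos_of_subsingleton (Set.subsingleton_of_ssubset_pair h).convexHull _
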